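/- Let N be a positive integer, p ∈ (0, 1/2], let M ∈ ℝ^{N×N} be a real symmetric matrix, and let V be a nonempty finite subset of ℝ^N. Let ε and ε' be independent transductive Rademacher vectors with parameter p. Then E_ε[ sup_{v ∈ V} |⟨ε, M v⟩| ] ≤ (2p)^{−1/2} · E_{ε'}[ √(ε'ᵀ M² ε') · sup_{v ∈ V} |⟨ε', v⟩| ]. -/

import Mathlib

open Finset

/-- Expectation with respect to a transductive Rademacher vector
`ε ∈ ℝ^N` with i.i.d. coordinates: `P(ε_i = 1) = P(ε_i = -1) = p`,
`P(ε_i = 0) = 1 - 2p`. -/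
noncomputable def tExp (N : ℕ) (p : ℝ) (f : (Fin N → ℝ) → ℝ) : ℝ :=
  ∑ s : Fin N → Fin 3,
    (∏ i, (![p, p, 1 - 2 * p] : Fin 3 → ℝ) (s i)) *
      f (fun i => (![(1 : ℝ), -1, 0]) (s i))

section TransductiveRademacher

variable {N : ℕ} {p : ℝ}

theorem tExp_weight_nonneg (hp0 : 0 ≤ p) (hp : p ≤ 1 / 2) (s : Fin N → Fin 3) :
    0 ≤ ∏ i, (![p, p, 1 - 2 * p] : Fin 3 → ℝ) (s i) := by
  refine Finset.prod_nonneg fun i _ => ?_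
  generalize s i = j
  fin_cases j
  · exact hp0
  · exact hp0
  · change 0 ≤ 1 - 2 * p
    linarith

theorem tExp_mono (hp0 : 0 ≤ p) (hp : p ≤ 1 / 2) {f g : (Fin N → ℝ) → ℝ}
    (h : ∀ x, f x ≤ g x) : tExp N p f ≤ tExp N p g :=
  Finset.sum_le_sum fun s _ =>
    mul_le_mul_of_nonneg_left (h _) (tExp_weight_nonneg hp0 hp s)

theorem tExp_const_mul (c : ℝ) (f : (Fin N → ℝ) → ℝ) :
    tExp N p (fun x => c * f x) = c * tExp N p f := by
  simp only [tExp, Finset.mul_sum]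
  exact Finset.sum_congr rfl fun s _ => by ring

theorem tExp_mul_const (c : ℝ) (f : (Fin N → ℝ) → ℝ) :
    tExp N p (fun x => f x * c) = tExp N p f * c := by
  simp only [mul_comm _ c, tExp_const_mul]

theorem tExp_sum {ι : Type*} (t : Finset ι) (f : ι → (Fin N → ℝ) → ℝ) :
    tExp N p (fun x => ∑ i ∈ t, f i x) = ∑ i ∈ t, tExp N p (f i) := by
  simp only [tExp, Finset.mul_sum]
  exact Finset.sum_comm

theorem tExp_comm (f : (Fin N → ℝ) → (Fin N → ℝ) → ℝ) :
    tExp N p (fun x => tExp N p (fun y => f x y)) =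
      tExp N p (fun y => tExp N p (fun x => f x y)) := by
  simp only [tExp, Finset.mul_sum]
  rw [Finset.sum_comm]
  exact Finset.sum_congr rfl fun s _ => Finset.sum_congr rfl fun t _ => by ring

theorem abs_tExp_le (hp0 : 0 ≤ p) (hp : p ≤ 1 / 2) (f : (Fin N → ℝ) → ℝ) :
    |tExp N p f| ≤ tExp N p (fun x => |f x|) := by
  refine (Finset.abs_sum_le_sum_abs _ _).trans_eq (Finset.sum_congr rfl fun s _ => ?_)
  rw [abs_mul, abs_of_nonneg (tExp_weight_nonneg hp0 hp s)]

theorem tExp_prod (h : Fin N → ℝ → ℝ) :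
    tExp N p (fun x => ∏ k, h k (x k)) =
      ∏ k, (p * h k 1 + p * h k (-1) + (1 - 2 * p) * h k 0) := by
  simp only [tExp, ← Finset.prod_mul_distrib]
  rw [← Fintype.piFinset_univ, ← Finset.prod_univ_sum (fun _ => Finset.univ)
    (fun k j => (![p, p, 1 - 2 * p] : Fin 3 → ℝ) j * h k ((![(1 : ℝ), -1, 0]) j))]
  simp [Fin.sum_univ_three]

theorem tExp_weight_sum :
    ∑ s : Fin N → Fin 3, ∏ i, (![p, p, 1 - 2 * p] : Fin 3 → ℝ) (s i) = 1 := by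
  have h := tExp_prod (N := N) (p := p) (fun _ _ => 1)
  simp only [tExp, Finset.prod_const_one, mul_one] at h
  rw [h]
  exact Finset.prod_eq_one fun _ _ => by ring

theorem tExp_coord_mul (i j : Fin N) :
    tExp N p (fun x => x i * x j) = if i = j then 2 * p else 0 := by
  have h := tExp_prod (N := N) (p := p)
    (fun k x => (if k = i then x else 1) * (if k = j then x else 1))
  simp only [Finset.prod_mul_distrib, Finset.prod_ite_eq', Finset.mem_univ, if_true] at h
  rw [h]
  split_ifs with hij
  · subst hij
    rw [Finset.prod_eq_single i]
    · simp only [if_true]; ring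
    · intro k _ hk
      simp only [hk, if_false]; ring
    · simp
  · refine Finset.prod_eq_zero (Finset.mem_univ i) ?_
    simp only [if_true, hij, if_false]; ring

theorem tExp_inner_mul_inner (a b : Fin N → ℝ) :
    tExp N p (fun x => (∑ i, a i * x i) * ∑ i, x i * b i) = 2 * p * ∑ i, a i * b i := by
  have h : ∀ x : Fin N → ℝ, (∑ i, a i * x i) * ∑ i, x i * b i =
      ∑ i, ∑ j, (a i * b j) * (x i * x j) := fun x => by
    rw [Finset.sum_mul_sum]
    exact Finset.sum_congr rfl fun i _ => Finset.sum_congr rfl fun j _ => by ring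
  simp only [h, tExp_sum, tExp_const_mul, tExp_coord_mul, mul_ite, mul_zero,
    Finset.sum_ite_eq, Finset.mem_univ, if_true, Finset.mul_sum]
  exact Finset.sum_congr rfl fun i _ => by ring

theorem tExp_abs_inner_le (hp0 : 0 ≤ p) (hp : p ≤ 1 / 2) (w : Fin N → ℝ) :
    tExp N p (fun x => |∑ i, x i * w i|) ≤ √(2 * p) * √(∑ i, w i * w i) := by
  rw [← Real.sqrt_mul (by linarith), ← tExp_inner_mul_inner]
  refine Real.le_sqrt_of_sq_le ?_
  refine (Real.pow_arith_mean_le_arith_mean_pow Finset.univ _ _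
    (fun s _ => tExp_weight_nonneg hp0 hp s) tExp_weight_sum
    (fun s _ => abs_nonneg _) 2).trans_eq ?_
  refine Finset.sum_congr rfl fun s _ => ?_
  simp only [sq, abs_mul_abs_self, mul_comm (w _)]

theorem tExp_sup_decoupling (hp0 : 0 < p) (hp : p ≤ 1 / 2)
    (M : Matrix (Fin N) (Fin N) ℝ) (V : Finset (Fin N → ℝ)) (hV : V.Nonempty)
    (x : Fin N → ℝ) :
    V.sup' hV (fun v => |∑ n, x n * M.mulVec v n|) ≤
      (2 * p)⁻¹ * tExp N p (fun y => |∑ n, x n * M.mulVec y n| *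
        V.sup' hV (fun v => |∑ n, y n * v n|)) := by
  refine Finset.sup'_le hV _ fun v hv => ?_
  have hmul : ∀ y : Fin N → ℝ,
      ∑ n, x n * M.mulVec y n = ∑ n, Matrix.vecMul x M n * y n :=
    fun y => Matrix.dotProduct_mulVec x M y
  rw [le_inv_mul_iff₀ (by linarith), ← abs_of_pos (show 0 < 2 * p by linarith), ← abs_mul,
    hmul v, ← tExp_inner_mul_inner]
  refine (abs_tExp_le hp0.le hp _).trans (tExp_mono hp0.le hp fun y => ?_)
  rw [abs_mul, hmul y]
  exact mul_le_mul_of_nonneg_left (Finset.le_sup' (fun v => |∑ n, y n * v n|) hv)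
    (abs_nonneg _)

end TransductiveRademacher

theorem Matrix.IsHermitian.sum_mulVec_mul_self {N : ℕ} {M : Matrix (Fin N) (Fin N) ℝ}
    (hM : M.IsHermitian) (y : Fin N → ℝ) :
    ∑ i, M.mulVec y i * M.mulVec y i = ∑ i, y i * (M ^ 2).mulVec y i := by
  have hT : M.transpose = M := by simpa using hM.eq
  change M.mulVec y ⬝ᵥ M.mulVec y = y ⬝ᵥ (M ^ 2).mulVec y
  rw [sq, ← Matrix.mulVec_mulVec, Matrix.dotProduct_mulVec y, ← Matrix.mulVec_transpose, hT]

/-- Decoupling combined with Cauchy–Schwarz: for a symmetric matrix `M`,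
`E_ε[sup_v |⟨ε, Mv⟩|] ≤ (2p)^{-1/2} E_{ε'}[√(ε'ᵀ M² ε') sup_v |⟨ε', v⟩|]`. -/
theorem rademacher_decoupling_cauchy_schwarz
    (N : ℕ) (hN : 0 < N) (p : ℝ) (hp0 : 0 < p) (hp : p ≤ 1 / 2)
    (M : Matrix (Fin N) (Fin N) ℝ) (hM : M.IsHermitian)
    (V : Finset (Fin N → ℝ)) (hV : V.Nonempty) :
    tExp N p (fun ε => V.sup' hV (fun v => |∑ n, ε n * M.mulVec v n|))
      ≤ (2 * p) ^ (-(1 : ℝ) / 2) *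
        tExp N p (fun ε' =>
          Real.sqrt (∑ i, ε' i * (M ^ 2).mulVec ε' i) *
            V.sup' hV (fun v => |∑ n, ε' n * v n|)) := by
  have hc : (2 * p) ^ (-(1 : ℝ) / 2) = (2 * p)⁻¹ * √(2 * p) := by
    rw [Real.sqrt_eq_rpow, ← Real.rpow_neg_one, ← Real.rpow_add (by linarith)]
    norm_num
  have hsup : ∀ y : Fin N → ℝ, 0 ≤ V.sup' hV (fun v => |∑ n, y n * v n|) := fun y =>
    Finset.le_sup'_of_le _ hV.choose_spec (abs_nonneg (∑ n, y n * hV.choose n))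
  calc tExp N p (fun x => V.sup' hV (fun v => |∑ n, x n * M.mulVec v n|))
      ≤ tExp N p (fun x => (2 * p)⁻¹ * tExp N p (fun y => |∑ n, x n * M.mulVec y n| *
          V.sup' hV (fun v => |∑ n, y n * v n|))) :=
        tExp_mono hp0.le hp (tExp_sup_decoupling hp0 hp M V hV)
    _ = (2 * p)⁻¹ * tExp N p (fun y => tExp N p (fun x => |∑ n, x n * M.mulVec y n|) *
          V.sup' hV (fun v => |∑ n, y n * v n|)) := by
        rw [tExp_const_mul, tExp_comm]
        simp only [tExp_mul_const]
    _ ≤ (2 * p)⁻¹ * tExp N p (fun y => √(2 * p) *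
          (√(∑ i, y i * (M ^ 2).mulVec y i) * V.sup' hV (fun v => |∑ n, y n * v n|))) := by
        refine mul_le_mul_of_nonneg_left (tExp_mono hp0.le hp fun y => ?_)
          (inv_nonneg.2 (by linarith))
        rw [← mul_assoc, ← hM.sum_mulVec_mul_self]
        exact mul_le_mul_of_nonneg_right (tExp_abs_inner_le hp0.le hp _) (hsup y)
    _ = _ := by rw [tExp_const_mul, hc, mul_assoc]
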